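/- arXiv:2108.08817 — 2 statements merged into one kernel-verified Lean document; each statement's English description precedes it below -/
import Mathlib

section
/- Let A be a proper submodule of ℂ[x,y]. Let d be the smallest nonnegative integer such that x^d·y^m ∉ A for some m ≥ 0, and let s be the smallest nonnegative integer such that x^d·y^s ∉ A. Then for every F ∈ A and every n ≥ s, deg [F]_n < max(d, max_{0 ≤ i ≤ s−1} deg [F]_i), where deg denotes the degree in x and the zero polynomial has degree −∞ (for s = 0 the inner maximum is −∞). -/
open Polynomial
open scoped Pointwise BigOperators

noncomputable section

/-- `ℂ[x,y]` as `ℂ[x][y]`: outer variable is `y`, inner variable is `x`. -/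
abbrev R2 : Type := Polynomial (Polynomial ℂ)

/-- The polynomial `(x,y) ↦ F(x+a, y+b)`. -/
noncomputable def polyTranslate (a b : ℂ) (F : R2) : R2 :=
  (F.map (aeval (X + C a) : Polynomial ℂ →ₐ[ℂ] Polynomial ℂ).toRingHom).comp (X + C (C b))

/-- A submodule of `ℂ[x,y]`: a translation invariant `ℂ`-linear subspace. -/
def IsSubmodule (M : Set R2) : Prop :=
  (0 ∈ M) ∧ (∀ F ∈ M, ∀ G ∈ M, F + G ∈ M) ∧ (∀ (c : ℂ), ∀ F ∈ M, c • F ∈ M) ∧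
    (∀ F ∈ M, ∀ a b : ℂ, polyTranslate a b F ∈ M)

/-- The `n`-th coordinate polynomial `[F]_n ∈ ℂ[x]`, so that `F = ∑ [F]_n · yⁿ/n!`. -/
noncomputable def coordPoly (F : R2) (n : ℕ) : Polynomial ℂ := (n.factorial : ℂ) • F.coeff n

/-- An L-module of order `s`. -/
def IsLModule (s : ℕ) (M : Set R2) : Prop :=
  IsSubmodule M ∧ ∀ F ∈ M, (∀ n < s, coordPoly F n = 0) → F = 0

/-- `M_d = {F : deg_x F < d}`. -/
def Md (d : ℕ) : Set R2 := {F | ∀ n, (coordPoly F n).degree < (d : WithBot ℕ)}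

/-- The map `L(f_1,…,f_s) = ∑_{i=1}^{s} ∑_{j=1}^{∞} a_{i,j} f_i^{(j)}`, where `a i j`
represents `a_{i+1, j+1}`. -/
noncomputable def Lmap {s : ℕ} (a : Fin s → ℕ → ℂ) (f : Fin s → Polynomial ℂ) :
    Polynomial ℂ :=
  ∑ i : Fin s, ∑ᶠ j : ℕ, a i (j + 1) • (Polynomial.derivative^[j + 1] (f i))

/-- `V_{A,s} = {([F]_0, …, [F]_{s−1}) : F ∈ A}`. -/
def Vset (A : Set R2) (s : ℕ) : Set (Fin s → Polynomial ℂ) :=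
  {φ | ∃ F ∈ A, ∀ i : Fin s, φ i = coordPoly F i}

/-- A submodule is decomposable if it is the sum of finitely many proper submodules. -/
def Decomposable (M : Set R2) : Prop :=
  ∃ (k : ℕ) (A : Fin k → Set R2), 0 < k ∧ (∀ i, IsSubmodule (A i) ∧ A i ⊂ M) ∧
    M = ∑ i : Fin k, A i

/-- The complex subspace underlying a translation invariant subspace. -/
def IsSubmodule.toSubmodule {M : Set R2} (hM : IsSubmodule M) : Submodule ℂ R2 where
  carrier := M
  zero_mem' := hM.1
  add_mem' := fun {F G} hF hG => hM.2.1 F hF G hG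
  smul_mem' := fun c F hF => hM.2.2.1 c F hF

theorem degree_coordPoly (F : R2) (n : ℕ) : (coordPoly F n).degree = (F.coeff n).degree :=
  degree_smul_of_smul_regular _
    (IsSMulRegular.of_ne_zero (Nat.cast_ne_zero.mpr n.factorial_ne_zero))

/-- If a polynomial curve lies in a subspace, then so do all its coefficients. -/
theorem mem_of_forall_sum_pow_smul_mem {K V : Type*} [Field K] [Infinite K] [AddCommGroup V]
    [Module K V] (W : Submodule K V) (N : ℕ) (v : ℕ → V)
    (h : ∀ a : K, ∑ k ∈ Finset.range N, a ^ k • v k ∈ W) {k : ℕ} (hk : k < N) : v k ∈ W := by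
  by_contra hv
  obtain ⟨f, hf, hW⟩ := Submodule.exists_le_ker_of_notMem hv
  have hp : (∑ k ∈ Finset.range N, monomial k (f (v k)) : K[X]) = 0 := by
    refine Polynomial.funext fun a => ?_
    have := hW (h a)
    simpa [eval_finsetSum, mul_comm] using this
  have := congrArg (fun p => coeff p k) hp
  simp only [finsetSum_coeff, coeff_monomial, coeff_zero, Finset.sum_ite_eq',
    Finset.mem_range, hk, if_true] at this
  exact hf this

theorem taylor_eq_sum_hasseDeriv {R : Type*} [CommSemiring R] (r : R) (f : R[X]) {N : ℕ}
    (hN : f.natDegree < N) :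
    taylor r f = ∑ k ∈ Finset.range N, r ^ k • hasseDeriv k f := by
  ext n
  have hn : (hasseDeriv n f).natDegree < N :=
    (natDegree_hasseDeriv_le f n).trans_lt (by omega)
  rw [taylor_coeff, eval_eq_sum_range' hn, finsetSum_coeff]
  refine Finset.sum_congr rfl fun k _ => ?_
  rw [coeff_smul, hasseDeriv_coeff, hasseDeriv_coeff, smul_eq_mul, add_comm k n,
    Nat.choose_symm_add]
  ring

theorem hasseDeriv_mem {M : Set R2} (hM : IsSubmodule M) {F : R2} (hF : F ∈ M) (k : ℕ) :
    hasseDeriv k F ∈ M := by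
  refine mem_of_forall_sum_pow_smul_mem hM.toSubmodule (F.natDegree + k + 1)
    (fun k => hasseDeriv k F) (fun b => ?_) (by omega)
  have h := hM.2.2.2 F hF 0 b
  have hT : polyTranslate 0 b F = taylor (C b) F := by
    have : (aeval (X + C 0) : ℂ[X] →ₐ[ℂ] ℂ[X]).toRingHom = RingHom.id _ := by
      ext <;> simp
    rw [polyTranslate, this, map_id, taylor_apply]
  rw [hT, taylor_eq_sum_hasseDeriv (C b) F (N := F.natDegree + k + 1) (by omega)] at h
  have hs : ∀ (j : ℕ) (G : R2), (C b ^ j : ℂ[X]) • G = b ^ j • G := fun j G => by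
    rw [← C_pow, ← algebraMap_eq, algebraMap_smul]
  simp only [hs] at h
  exact h

/-- The divided derivative with respect to the inner variable. -/
def innerHasseDeriv (k : ℕ) (F : R2) : R2 :=
  ∑ n ∈ F.support, monomial n (hasseDeriv k (F.coeff n))

theorem innerHasseDeriv_coeff (k : ℕ) (F : R2) (n : ℕ) :
    (innerHasseDeriv k F).coeff n = hasseDeriv k (F.coeff n) := by
  simp only [innerHasseDeriv, finsetSum_coeff, coeff_monomial, Finset.sum_ite_eq',
    mem_support_iff]
  split_ifs with h
  · rfl
  · rw [not_not.mp h, map_zero]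

theorem innerHasseDeriv_mem {M : Set R2} (hM : IsSubmodule M) {F : R2} (hF : F ∈ M) (k : ℕ) :
    innerHasseDeriv k F ∈ M := by
  set N := F.support.sup (fun n => (F.coeff n).natDegree) with hN
  refine mem_of_forall_sum_pow_smul_mem hM.toSubmodule (N + k + 1)
    (fun k => innerHasseDeriv k F) (fun a => ?_) (by omega)
  have h := hM.2.2.2 F hF a 0
  change _ ∈ M
  convert h using 1
  ext1 n
  have hn : (F.coeff n).natDegree < N + k + 1 := by
    by_cases h0 : F.coeff n = 0
    · simp [h0]
    · have := Finset.le_sup (f := fun n => (F.coeff n).natDegree) (mem_support_iff.mpr h0)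
      simp only [← hN] at this
      omega
  have hT := taylor_eq_sum_hasseDeriv a (F.coeff n) hn
  rw [polyTranslate, C_0, C_0, add_zero, comp_X, coeff_map]
  simp only [finsetSum_coeff, coeff_smul, innerHasseDeriv_coeff]
  rw [← hT, taylor_apply]
  rfl

theorem mem_of_forall_monomial_mem (W : Submodule ℂ R2) {F : R2}
    (h : ∀ n m, (F.coeff n).coeff m ≠ 0 → (C (X ^ m) * X ^ n : R2) ∈ W) : F ∈ W := by
  rw [F.as_sum_support_C_mul_X_pow]
  refine W.sum_mem fun n _ => ?_
  have : (C (F.coeff n) * X ^ n : R2) =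
      ∑ m ∈ (F.coeff n).support, (F.coeff n).coeff m • (C (X ^ m) * X ^ n : R2) := by
    conv_lhs => rw [(F.coeff n).as_sum_support_C_mul_X_pow]
    simp only [map_sum, Finset.sum_mul]
    refine Finset.sum_congr rfl fun m _ => ?_
    rw [← smul_eq_C_mul ((F.coeff n).coeff m), ← smul_C, smul_mul_assoc]
  rw [this]
  exact W.sum_mem fun m hm => W.smul_mem _ (h n m (mem_support_iff.mp hm))

/-- If all monomials of `F ∈ W` other than `x^d y^s` lie in `W`, then so does `x^d y^s`,
provided it occurs in `F`. -/
theorem monomial_mem_of_mem (W : Submodule ℂ R2) {F : R2} (hF : F ∈ W) {d s : ℕ}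
    (h : ∀ n m, (F.coeff n).coeff m ≠ 0 → (n, m) ≠ (s, d) → (C (X ^ m) * X ^ n : R2) ∈ W)
    (hc : (F.coeff s).coeff d ≠ 0) : (C (X ^ d) * X ^ s : R2) ∈ W := by
  have hsub : F - (F.coeff s).coeff d • (C (X ^ d) * X ^ s : R2) ∈ W := by
    refine mem_of_forall_monomial_mem W fun n m hnm => ?_
    rw [coeff_sub, coeff_smul, coeff_C_mul_X_pow, coeff_sub, coeff_smul] at hnm
    by_cases hn : n = s
    · subst hn
      by_cases hm : m = d
      · subst hm
        simp at hnm
      · refine h n m ?_ (by simp [hm])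
        simpa [coeff_X_pow, hm] using hnm
    · refine h n m ?_ (by simp [hn])
      simpa [hn] using hnm
  have := W.sub_mem hF hsub
  rw [sub_sub_cancel] at this
  exact (W.smul_mem_iff hc).mp this

/-- If `F` has degree `e ≥ d` in `x`, attained at a coefficient of index at least `s`, then
`A` contains an element of degree at most `d` in `x` in which `x^d y^s` occurs and in which
`x^d y^n` does not for `n > s`. -/
theorem exists_mem_coeff_ne_zero {A : Set R2} (hA : IsSubmodule A) {F : R2} (hF : F ∈ A)
    {d e s n : ℕ} (hde : d ≤ e) (hsn : s ≤ n) (hdeg : ∀ i, (F.coeff i).natDegree ≤ e)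
    (hn : (F.coeff n).coeff e ≠ 0) :
    ∃ H ∈ A, (H.coeff s).coeff d ≠ 0 ∧ (∀ i, (H.coeff i).natDegree ≤ d) ∧
      ∀ i > s, (H.coeff i).coeff d = 0 := by
  have hne : (F.support.filter fun i => (F.coeff i).coeff e ≠ 0).Nonempty := by
    refine ⟨n, Finset.mem_filter.mpr ⟨mem_support_iff.mpr fun h0 => hn ?_, hn⟩⟩
    rw [h0, coeff_zero]
  obtain ⟨N, hN, hmax⟩ := Finset.exists_max_image _ id hne
  have hNmax : ∀ i, (F.coeff i).coeff e ≠ 0 → i ≤ N := fun i hi =>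
    hmax i (Finset.mem_filter.mpr ⟨mem_support_iff.mpr fun h0 => hi (by rw [h0, coeff_zero]), hi⟩)
  have hsN : s ≤ N := hsn.trans (hNmax n hn)
  have hNe := (Finset.mem_filter.mp hN).2
  refine ⟨hasseDeriv (N - s) (innerHasseDeriv (e - d) F),
    hasseDeriv_mem hA (innerHasseDeriv_mem hA hF _) _, ?_, fun i => ?_, fun i hi => ?_⟩
  · rw [hasseDeriv_coeff, innerHasseDeriv_coeff, coeff_natCast_mul, hasseDeriv_coeff,
      Nat.add_sub_cancel' hsN, Nat.add_sub_cancel' hde]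
    refine mul_ne_zero ?_ (mul_ne_zero ?_ hNe) <;>
      exact Nat.cast_ne_zero.mpr (Nat.choose_pos (Nat.sub_le _ _)).ne'
  · rw [hasseDeriv_coeff, innerHasseDeriv_coeff, natDegree_le_iff_coeff_eq_zero]
    intro m hm
    rw [coeff_natCast_mul, hasseDeriv_coeff,
      coeff_eq_zero_of_natDegree_lt ((hdeg _).trans_lt (by omega)), mul_zero, mul_zero]
  · have h0 : (F.coeff (i + (N - s))).coeff e = 0 := by
      by_contra h
      have := hNmax _ h
      omega
    rw [hasseDeriv_coeff, innerHasseDeriv_coeff, coeff_natCast_mul, hasseDeriv_coeff,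
      Nat.add_sub_cancel' hde, h0, mul_zero, mul_zero]

/-- Lemma 4 of the paper: with `d` the least exponent such that `x^d yᵐ ∉ A` for some `m`,
and `s` the least exponent with `x^d yˢ ∉ A`, every `F ∈ A` satisfies
`deg [F]_n < max(d, max_{i<s} deg [F]_i)` for all `n ≥ s`. -/
theorem stmt5 (A : Set R2) (hA : IsSubmodule A) (hAp : A ≠ Set.univ) (d s : ℕ)
    (hd1 : ∃ m : ℕ, (C (X ^ d) * X ^ m : R2) ∉ A)
    (hd2 : ∀ d' < d, ∀ m : ℕ, (C (X ^ d') * X ^ m : R2) ∈ A)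
    (hs1 : (C (X ^ d) * X ^ s : R2) ∉ A)
    (hs2 : ∀ s' < s, (C (X ^ d) * X ^ s' : R2) ∈ A) :
    ∀ F ∈ A, ∀ n : ℕ, s ≤ n →
      (coordPoly F n).degree <
        max (d : WithBot ℕ) ((Finset.range s).sup fun i => (coordPoly F i).degree) := by
  intro F hF n hsn
  by_contra hlt
  rw [not_lt, max_le_iff, Finset.sup_le_iff] at hlt
  simp only [degree_coordPoly, Finset.mem_range] at hlt
  obtain ⟨hdn, hin⟩ := hlt
  have hn0 : F.coeff n ≠ 0 := by
    rintro h0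
    simp [h0] at hdn
  obtain ⟨N, hN, hmax⟩ := Finset.exists_max_image F.support (fun i => (F.coeff i).natDegree)
    ⟨n, mem_support_iff.mpr hn0⟩
  have hdeg : ∀ i, (F.coeff i).natDegree ≤ (F.coeff N).natDegree := fun i => by
    by_cases hi : F.coeff i = 0
    · simp [hi]
    · exact hmax i (mem_support_iff.mpr hi)
  have hde : d ≤ (F.coeff N).natDegree :=
    (le_natDegree_of_coe_le_degree hdn).trans (hdeg n)
  obtain ⟨n', hsn', hn'⟩ : ∃ n', s ≤ n' ∧ (F.coeff n').coeff (F.coeff N).natDegree ≠ 0 := by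
    rcases le_or_gt s N with h | h
    · exact ⟨N, h, leadingCoeff_ne_zero.mpr (mem_support_iff.mp hN)⟩
    · have : (F.coeff N).natDegree = (F.coeff n).natDegree :=
        (natDegree_le_natDegree (hin N h)).antisymm (hdeg n)
      exact ⟨n, hsn, this ▸ leadingCoeff_ne_zero.mpr hn0⟩
  obtain ⟨H, hH, hHs, hHd, hHi⟩ := exists_mem_coeff_ne_zero hA hF hde hsn' hdeg hn'
  refine hs1 (monomial_mem_of_mem hA.toSubmodule hH (fun i m him hne => ?_) hHs)
  have hmd : m ≤ d := (le_natDegree_of_ne_zero him).trans (hHd i)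
  rcases hmd.lt_or_eq with hm | rfl
  · exact hd2 m hm i
  · refine hs2 i (lt_of_le_of_ne (not_lt.mp fun hi => him (hHi i hi)) fun hi => hne ?_)
    rw [hi]
end
end

section
/- If A and B are L-modules in ℂ[x,y] (of orders s_1 and s_2 respectively), then A + B is an L-module, i.e. there exists a positive integer K such that A + B is an L-module of order K. -/
open Polynomial
open scoped Pointwise BigOperators

noncomputable section

section LinearAlgebra

open Module

variable {k V : Type*} [Field k] [AddCommGroup V] [Module k V]

/-- If `T` has finite-dimensional kernel on an invariant subspace, then so do its powers. -/
lemma fg_inf_ker_pow (T : End k V) {A : Submodule k V} (hA : A.map T ≤ A)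
    (hfg : (A ⊓ LinearMap.ker T).FG) (d : ℕ) : (A ⊓ LinearMap.ker (T ^ d)).FG := by
  induction d with
  | zero =>
    have : LinearMap.ker (T ^ 0) = ⊥ := by ext; simp
    rw [this, inf_bot_eq]
    exact Submodule.fg_bot
  | succ d ih =>
    refine Submodule.fg_of_fg_map_of_fg_inf_ker T (Submodule.FG.of_le ih ?_)
      (Submodule.FG.of_le hfg (inf_le_inf_right _ inf_le_left))
    rintro _ ⟨v, ⟨hvA, hv⟩, rfl⟩
    refine ⟨hA ⟨v, hvA, rfl⟩, ?_⟩
    simpa [pow_succ] using hv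

lemma finrank_map_add_finrank_inf_ker (T : End k V) (M : Submodule k V) [FiniteDimensional k M] :
    finrank k (M.map T) + finrank k ↥(M ⊓ LinearMap.ker T) = finrank k M := by
  have h := LinearMap.finrank_range_add_finrank_ker (T.domRestrict M)
  rw [LinearMap.range_domRestrict, LinearMap.ker_domRestrict] at h
  rw [← h, ← Submodule.finrank_map_subtype_eq M ((LinearMap.ker T).comap M.subtype),
    Submodule.map_comap_subtype]

/-- The nullity of an endomorphism is subadditive on finite-dimensional invariant subspaces. -/
lemma finrank_sup_inf_ker_le (T : End k V) {A B : Submodule k V} [FiniteDimensional k A]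
    [FiniteDimensional k B] (hA : A.map T ≤ A) (hB : B.map T ≤ B) :
    finrank k ↥((A ⊔ B) ⊓ LinearMap.ker T) ≤
      finrank k ↥(A ⊓ LinearMap.ker T) + finrank k ↥(B ⊓ LinearMap.ker T) := by
  have h₁ := finrank_map_add_finrank_inf_ker T A
  have h₂ := finrank_map_add_finrank_inf_ker T B
  have h₃ := finrank_map_add_finrank_inf_ker T (A ⊔ B)
  rw [Submodule.map_sup] at h₃
  have h₄ := Submodule.finrank_sup_add_finrank_inf_eq A B
  have h₅ := Submodule.finrank_sup_add_finrank_inf_eq (A.map T) (B.map T)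
  have : FiniteDimensional k ↥(A ⊓ B) := Submodule.finiteDimensional_inf_left A B
  have h₆ := Submodule.finrank_mono (inf_le_inf hA hB)
  omega

lemma map_inf_ker_pow_le {T S : End k V} (hTS : Commute T S) {A : Submodule k V}
    (hA : A.map S ≤ A) (d : ℕ) :
    (A ⊓ LinearMap.ker (T ^ d)).map S ≤ A ⊓ LinearMap.ker (T ^ d) := by
  rintro _ ⟨v, ⟨hvA, hv⟩, rfl⟩
  refine ⟨hA ⟨v, hvA, rfl⟩, ?_⟩
  have h := LinearMap.congr_fun (hTS.pow_left d).eq v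
  rw [SetLike.mem_coe, LinearMap.mem_ker] at hv
  rw [SetLike.mem_coe, LinearMap.mem_ker]
  simpa [hv] using h

/-- A locally nilpotent endomorphism of a space of dimension at most `s` vanishes to the power
`s`; stated for an invariant subspace. -/
lemma pow_apply_eq_zero_of_finrank_le (D : End k V) {U : Submodule k V} [FiniteDimensional k U]
    (hU : U.map D ≤ U) {s m : ℕ} (hs : finrank k U ≤ s) {h : V} (hh : h ∈ U)
    (hm : (D ^ m) h = 0) : (D ^ s) h = 0 := by
  have hU' : ∀ v ∈ U, D v ∈ U := fun v hv => hU ⟨v, hv, rfl⟩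
  have key (n : ℕ) : (((D.restrict hU') ^ n) ⟨h, hh⟩ : U) = (D ^ n) h := by
    rw [Module.End.pow_restrict n]
    rfl
  have hmem : (⟨h, hh⟩ : U) ∈ LinearMap.ker ((D.restrict hU') ^ (s + m)) := by
    rw [LinearMap.mem_ker, Subtype.ext_iff, key, pow_add]
    simp [hm]
  rw [Module.End.ker_pow_eq_ker_pow_finrank_of_le (hs.trans (Nat.le_add_right s m)),
    ← Module.End.ker_pow_eq_ker_pow_finrank_of_le hs, LinearMap.mem_ker, Subtype.ext_iff, key]
      at hmem
  exact hmem

/-- Let `T`, `D` be commuting endomorphisms, `T` locally nilpotent, with kernel on the invariant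
subspaces `A`, `B` of dimension at most `a`, `b`. Then `D ^ (a + b)` kills every vector of
`(A ⊔ B) ⊓ ker T` that is killed by some power of `D`. -/
lemma pow_apply_eq_zero_of_mem_sup_inf_ker {T D : End k V} (hTD : Commute T D)
    (hT : ∀ v, ∃ d, (T ^ d) v = 0) {A B : Submodule k V}
    (hAT : A.map T ≤ A) (hBT : B.map T ≤ B) (hAD : A.map D ≤ A) (hBD : B.map D ≤ B)
    (hAfg : (A ⊓ LinearMap.ker T).FG) (hBfg : (B ⊓ LinearMap.ker T).FG) {a b m : ℕ}
    (ha : finrank k ↥(A ⊓ LinearMap.ker T) ≤ a) (hb : finrank k ↥(B ⊓ LinearMap.ker T) ≤ b)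
    {h : V} (hAB : h ∈ A ⊔ B) (hTh : T h = 0) (hm : (D ^ m) h = 0) :
    (D ^ (a + b)) h = 0 := by
  obtain ⟨F, hF, G, hG, rfl⟩ := Submodule.mem_sup.mp hAB
  obtain ⟨d₁, hd₁⟩ := hT F
  obtain ⟨d₂, hd₂⟩ := hT G
  have hAf := fg_inf_ker_pow T hAT hAfg d₁
  have hBf := fg_inf_ker_pow T hBT hBfg d₂
  have hAT' := map_inf_ker_pow_le (Commute.refl T) hAT d₁
  have hBT' := map_inf_ker_pow_le (Commute.refl T) hBT d₂
  have hAD' := map_inf_ker_pow_le hTD hAD d₁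
  have hBD' := map_inf_ker_pow_le hTD hBD d₂
  have hFA : F ∈ A ⊓ LinearMap.ker (T ^ d₁) := ⟨hF, hd₁⟩
  have hGB : G ∈ B ⊓ LinearMap.ker (T ^ d₂) := ⟨hG, hd₂⟩
  have hA'A : A ⊓ LinearMap.ker (T ^ d₁) ≤ A := inf_le_left
  have hB'B : B ⊓ LinearMap.ker (T ^ d₂) ≤ B := inf_le_left
  generalize A ⊓ LinearMap.ker (T ^ d₁) = A' at *
  generalize B ⊓ LinearMap.ker (T ^ d₂) = B' at *
  have : FiniteDimensional k A' := Module.Finite.iff_fg.mpr hAf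
  have : FiniteDimensional k B' := Module.Finite.iff_fg.mpr hBf
  have : FiniteDimensional k ↥(A ⊓ LinearMap.ker T) := Module.Finite.iff_fg.mpr hAfg
  have : FiniteDimensional k ↥(B ⊓ LinearMap.ker T) := Module.Finite.iff_fg.mpr hBfg
  have : FiniteDimensional k ↥((A' ⊔ B') ⊓ LinearMap.ker T) :=
    Submodule.finiteDimensional_inf_left _ _
  refine pow_apply_eq_zero_of_finrank_le D (U := (A' ⊔ B') ⊓ LinearMap.ker T) ?_ ?_
    ⟨Submodule.add_mem_sup hFA hGB, hTh⟩ hm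
  · have hsup : (A' ⊔ B').map D ≤ A' ⊔ B' := by
      rw [Submodule.map_sup]
      exact sup_le_sup hAD' hBD'
    simpa using map_inf_ker_pow_le hTD hsup 1
  · have h₁ := Submodule.finrank_mono (inf_le_inf_right (LinearMap.ker T) hA'A)
    have h₂ := Submodule.finrank_mono (inf_le_inf_right (LinearMap.ker T) hB'B)
    have h₃ := finrank_sup_inf_ker_le T hAT' hBT'
    omega

end LinearAlgebra

section Difference

variable (R : Type*) [CommRing R]

/-- The forward difference operator `p(X) ↦ p(X + 1) - p(X)`. -/
def polyDiff : Module.End R R[X] := taylor 1 - 1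

variable {R}

lemma polyDiff_apply (p : R[X]) : polyDiff R p = taylor 1 p - p := rfl

lemma natDegree_polyDiff_lt {p : R[X]} (hp : p.natDegree ≠ 0) :
    (polyDiff R p).natDegree < p.natDegree := by
  have hp0 : p ≠ 0 := by rintro rfl; simp at hp
  by_cases h0 : polyDiff R p = 0
  · rw [h0, natDegree_zero]
    omega
  · refine natDegree_lt_natDegree h0 ?_
    rw [polyDiff_apply]
    have h := degree_sub_lt_left (degree_taylor p (1 : R)) ((taylor_eq_zero _ _).not.mpr hp0)
      (leadingCoeff_taylor 1 p)
    rwa [degree_taylor] at h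

lemma polyDiff_eq_zero_of_natDegree_eq_zero {p : R[X]} (hp : p.natDegree = 0) :
    polyDiff R p = 0 := by
  rw [eq_C_of_natDegree_eq_zero hp, polyDiff_apply, taylor_C, sub_self]

lemma polyDiff_pow_apply_eq_zero {p : R[X]} {d : ℕ} (hp : p.natDegree < d) :
    (polyDiff R ^ d) p = 0 := by
  induction d generalizing p with
  | zero => omega
  | succ d ih =>
    rw [pow_succ, Module.End.mul_apply]
    by_cases h0 : p.natDegree = 0
    · rw [polyDiff_eq_zero_of_natDegree_eq_zero h0, map_zero]
    · have := natDegree_polyDiff_lt h0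
      exact ih (by omega)

lemma coeff_polyDiff_of_natDegree_eq_succ {p : R[X]} {n : ℕ} (hp : p.natDegree = n + 1) :
    (polyDiff R p).coeff n = (n + 1) * p.leadingCoeff := by
  have hdeg : (hasseDeriv n p).natDegree < 2 := by
    have := natDegree_hasseDeriv_le p n
    omega
  rw [polyDiff_apply, coeff_sub, taylor_coeff, eval_eq_sum_range' hdeg]
  simp [Finset.sum_range_succ, hasseDeriv_coeff, leadingCoeff, hp, add_comm 1 n]

lemma polyDiff_pow_apply_ne_zero [IsDomain R] [CharZero R] {p : R[X]} (hp : p ≠ 0) {d : ℕ}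
    (hd : d ≤ p.natDegree) : (polyDiff R ^ d) p ≠ 0 := by
  induction d generalizing p with
  | zero => simpa using hp
  | succ d ih =>
    obtain ⟨n, hn⟩ : ∃ n, p.natDegree = n + 1 := ⟨p.natDegree - 1, by omega⟩
    have hc : (polyDiff R p).coeff n ≠ 0 := by
      rw [coeff_polyDiff_of_natDegree_eq_succ hn]
      exact mul_ne_zero (Nat.cast_add_one_ne_zero n) (leadingCoeff_ne_zero.mpr hp)
    rw [pow_succ, Module.End.mul_apply]
    refine ih (fun h => hc (by simp [h])) ?_
    have := le_natDegree_of_ne_zero hc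
    omega

end Difference

/-- The operator `F(x,y) ↦ F(x, y+1) - F(x,y)`. -/
def diffY : Module.End ℂ R2 := (polyDiff ℂ[X]).restrictScalars ℂ

/-- The operator `F(x,y) ↦ F(x+1, y) - F(x,y)`. -/
def diffX : Module.End ℂ R2 := (mapAlgHom (taylorAlgHom (1 : ℂ))).toLinearMap - 1

lemma diffX_apply (F : R2) : diffX F = F.map (taylorAlgHom (1 : ℂ)).toRingHom - F := rfl

lemma coeff_diffX (F : R2) (n : ℕ) : (diffX F).coeff n = polyDiff ℂ (F.coeff n) := by
  rw [diffX_apply, coeff_sub, coeff_map, polyDiff_apply]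
  rfl

lemma coeff_diffX_pow (F : R2) (d n : ℕ) :
    ((diffX ^ d) F).coeff n = (polyDiff ℂ ^ d) (F.coeff n) := by
  induction d generalizing F with
  | zero => simp
  | succ d ih => rw [pow_succ, pow_succ, Module.End.mul_apply, Module.End.mul_apply, ih,
      coeff_diffX]

lemma diffY_pow_apply (F : R2) (d : ℕ) : (diffY ^ d) F = (polyDiff ℂ[X] ^ d) F := by
  rw [Module.End.pow_apply, Module.End.pow_apply]
  rfl

lemma commute_diffX_diffY : Commute diffX diffY := by
  refine LinearMap.ext fun F => ?_
  change diffX (taylor 1 F - F) = taylor 1 (diffX F) - diffX F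
  rw [map_sub, diffX_apply, diffX_apply, map_sub, Polynomial.map_taylor, map_one]

lemma exists_diffX_pow_apply_eq_zero (F : R2) : ∃ d, (diffX ^ d) F = 0 := by
  refine ⟨F.support.sup (fun n => (F.coeff n).natDegree) + 1, ?_⟩
  ext1 n
  rw [coeff_diffX_pow, coeff_zero]
  by_cases hn : n ∈ F.support
  · exact polyDiff_pow_apply_eq_zero
      (Nat.lt_succ_of_le (Finset.le_sup (f := fun n => (F.coeff n).natDegree) hn))
  · rw [notMem_support_iff.mp hn, map_zero]

lemma coeff_eq_C_of_diffX_eq_zero {F : R2} (hF : diffX F = 0) (n : ℕ) :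
    F.coeff n = C ((F.coeff n).coeff 0) := by
  refine eq_C_of_natDegree_eq_zero ?_
  by_contra h
  have h0 : F.coeff n ≠ 0 := by rintro h0; simp [h0] at h
  refine polyDiff_pow_apply_ne_zero h0 (Nat.one_le_iff_ne_zero.mpr h) ?_
  rw [pow_one, ← coeff_diffX, hF, coeff_zero]

lemma polyTranslate_eq (a b : ℂ) (F : R2) :
    polyTranslate a b F = taylor (C b) (mapAlgHom (taylorAlgHom a) F) := by
  have h : (aeval (X + C a) : ℂ[X] →ₐ[ℂ] ℂ[X]) = taylorAlgHom a := by
    refine algHom_ext ?_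
    rw [aeval_X]
    exact (taylor_X a).symm
  rw [polyTranslate, h, taylor_apply]
  rfl

lemma polyTranslate_add (a b : ℂ) (F G : R2) :
    polyTranslate a b (F + G) = polyTranslate a b F + polyTranslate a b G := by
  simp only [polyTranslate_eq, map_add]

lemma diffX_eq_polyTranslate_sub (F : R2) : diffX F = polyTranslate 1 0 F - F := by
  rw [polyTranslate_eq, C_0, taylor_zero]
  rfl

lemma diffY_eq_polyTranslate_sub (F : R2) : diffY F = polyTranslate 0 1 F - F := by
  have h : taylorAlgHom (0 : ℂ) = AlgHom.id ℂ ℂ[X] := by ext; simp [taylorAlgHom]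
  rw [polyTranslate_eq, h, mapAlgHom_id, C_1]
  rfl

lemma coordPoly_eq_zero_iff {F : R2} {n : ℕ} : coordPoly F n = 0 ↔ F.coeff n = 0 := by
  simp [coordPoly, Nat.factorial_ne_zero]

namespace IsSubmodule

variable {M N : Set R2}

/-- The underlying `ℂ`-subspace of a translation invariant subspace. -/
def toSubmodule_s10 (hM : IsSubmodule M) : Submodule ℂ R2 where
  carrier := M
  zero_mem' := hM.1
  add_mem' := fun {F G} hF hG => hM.2.1 F hF G hG
  smul_mem' := hM.2.2.1

lemma map_diffX_le (hM : IsSubmodule M) : hM.toSubmodule_s10.map diffX ≤ hM.toSubmodule_s10 := by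
  rintro _ ⟨F, hF, rfl⟩
  rw [diffX_eq_polyTranslate_sub]
  exact Submodule.sub_mem _ (hM.2.2.2 F hF 1 0) hF

lemma map_diffY_le (hM : IsSubmodule M) : hM.toSubmodule_s10.map diffY ≤ hM.toSubmodule_s10 := by
  rintro _ ⟨F, hF, rfl⟩
  rw [diffY_eq_polyTranslate_sub]
  exact Submodule.sub_mem _ (hM.2.2.2 F hF 0 1) hF

lemma add (hM : IsSubmodule M) (hN : IsSubmodule N) : IsSubmodule (M + N) := by
  have hcoe : M + N = (hM.toSubmodule_s10 ⊔ hN.toSubmodule_s10 : Submodule ℂ R2) :=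
    (Submodule.coe_sup hM.toSubmodule_s10 hN.toSubmodule_s10).symm
  refine ⟨?_, ?_, ?_, ?_⟩
  · rw [hcoe]
    exact Submodule.zero_mem _
  · rw [hcoe]
    exact fun F hF G hG => Submodule.add_mem _ hF hG
  · rw [hcoe]
    exact fun c F hF => Submodule.smul_mem _ c hF
  · rintro _ ⟨F, hF, G, hG, rfl⟩ a b
    exact ⟨_, hM.2.2.2 F hF a b, _, hN.2.2.2 G hG a b, (polyTranslate_add a b F G).symm⟩

end IsSubmodule

/-- The constant terms of the first `s` coefficients in `y`. -/
def constCoeffs (s : ℕ) : R2 →ₗ[ℂ] Fin s → ℂ :=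
  LinearMap.pi fun i => lcoeff ℂ 0 ∘ₗ (lcoeff ℂ[X] i).restrictScalars ℂ

lemma constCoeffs_injOn {s : ℕ} {M : Set R2} (hM : IsLModule s M) :
    Function.Injective
      ((constCoeffs s).domRestrict (hM.1.toSubmodule_s10 ⊓ LinearMap.ker diffX)) := by
  rw [injective_iff_map_eq_zero]
  rintro ⟨F, hFM, hF⟩ h0
  refine Subtype.ext (hM.2 F hFM fun n hn => coordPoly_eq_zero_iff.mpr ?_)
  have h : (F.coeff n).coeff 0 = 0 := congrFun h0 ⟨n, hn⟩
  rw [coeff_eq_C_of_diffX_eq_zero hF, h, C_0]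

lemma fg_inf_ker_diffX {s : ℕ} {M : Set R2} (hM : IsLModule s M) :
    (hM.1.toSubmodule_s10 ⊓ LinearMap.ker diffX).FG :=
  Module.Finite.iff_fg.mp (Module.Finite.of_injective _ (constCoeffs_injOn hM))

lemma finrank_inf_ker_diffX_le {s : ℕ} {M : Set R2} (hM : IsLModule s M) :
    Module.finrank ℂ ↥(hM.1.toSubmodule_s10 ⊓ LinearMap.ker diffX) ≤ s := by
  simpa using LinearMap.finrank_le_finrank_of_injective (constCoeffs_injOn hM)

/-- If `A` and `B` are L-modules, then so is `A + B`: it is an L-module of some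
order `K`. -/
theorem stmt10 (s₁ s₂ : ℕ) (hs₁ : 0 < s₁) (hs₂ : 0 < s₂) (A B : Set R2)
    (hA : IsLModule s₁ A) (hB : IsLModule s₂ B) :
    ∃ K : ℕ, 0 < K ∧ IsLModule K (A + B) := by
  refine ⟨s₁ + s₂, by omega, hA.1.add hB.1, ?_⟩
  intro H hH hcoord
  by_contra hH0
  have hex := exists_diffX_pow_apply_eq_zero H
  obtain ⟨m, hm⟩ : ∃ m, Nat.find hex = m + 1 :=
    Nat.exists_eq_succ_of_ne_zero fun h => hH0 (by simpa [h] using Nat.find_spec hex)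
  have hm0 : (diffX ^ m) H ≠ 0 := Nat.find_min hex (by omega)
  have hm1 : diffX ((diffX ^ m) H) = 0 := by
    have := Nat.find_spec hex
    rwa [hm, pow_succ', Module.End.mul_apply] at this
  have hmem : (diffX ^ m) H ∈ hA.1.toSubmodule_s10 ⊔ hB.1.toSubmodule_s10 := by
    have hsup (F : R2) (hF : F ∈ hA.1.toSubmodule_s10 ⊔ hB.1.toSubmodule_s10) :
        diffX F ∈ hA.1.toSubmodule_s10 ⊔ hB.1.toSubmodule_s10 := by
      have := Submodule.mem_map_of_mem (f := diffX) hF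
      rw [Submodule.map_sup] at this
      exact sup_le_sup hA.1.map_diffX_le hB.1.map_diffX_le this
    have hH' : H ∈ hA.1.toSubmodule_s10 ⊔ hB.1.toSubmodule_s10 := by
      obtain ⟨F, hF, G, hG, rfl⟩ := hH
      exact Submodule.add_mem_sup hF hG
    exact Module.End.pow_apply_mem_of_forall_mem m hsup H hH'
  have hdeg : s₁ + s₂ ≤ ((diffX ^ m) H).natDegree := by
    by_contra hlt
    refine hm0 (leadingCoeff_eq_zero.mp ?_)
    rw [leadingCoeff, coeff_diffX_pow, coordPoly_eq_zero_iff.mp (hcoord _ (by omega)), map_zero]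
  refine polyDiff_pow_apply_ne_zero hm0 hdeg ?_
  rw [← diffY_pow_apply]
  refine pow_apply_eq_zero_of_mem_sup_inf_ker commute_diffX_diffY exists_diffX_pow_apply_eq_zero
    hA.1.map_diffX_le hB.1.map_diffX_le hA.1.map_diffY_le hB.1.map_diffY_le (fg_inf_ker_diffX hA)
    (fg_inf_ker_diffX hB) (finrank_inf_ker_diffX_le hA) (finrank_inf_ker_diffX_le hB) hmem hm1
    (m := ((diffX ^ m) H).natDegree + 1) ?_
  rw [diffY_pow_apply]
  exact polyDiff_pow_apply_eq_zero (Nat.lt_succ_self _)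
end
end
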